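/- Let a, b > 0 and c = √(a² + b²). Set f(t) = b(c cosh(t) − a)/√(c² cosh²(t) − a²) and let G(t) = ab²/((c cosh(t) + a)√(c² cosh²(t) − a²)) denote the derivative of the height function of the nodoid. Then for every t ∈ ℝ, twice the mean curvature of the nodoid equals −1/a: (f'(t)G'(t) − f''(t)G(t))/(f'(t)² + G(t)²)^{3/2} + G(t)/(f(t)√(f'(t)² + G(t)²)) = −1/a. In particular the nodoid has constant mean curvature H = −1/(2a), minus the reciprocal of the distance between the vertices of the generating hyperbola. -/

import Mathlib

/-- The nodoid has constant mean curvature `H = −1/(2a)`: twice its mean curvature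
equals `−1/a`, minus the reciprocal of the distance between the vertices of the
generating hyperbola. -/
theorem nodoid_constant_mean_curvature
    (a b c : ℝ) (ha : 0 < a) (hb : 0 < b) (hc : c = Real.sqrt (a ^ 2 + b ^ 2))
    (f G : ℝ → ℝ)
    (hf : f = fun t => b * (c * Real.cosh t - a) /
      Real.sqrt (c ^ 2 * Real.cosh t ^ 2 - a ^ 2))
    (hG : G = fun t => a * b ^ 2 /
      ((c * Real.cosh t + a) * Real.sqrt (c ^ 2 * Real.cosh t ^ 2 - a ^ 2))) :
    ∀ t : ℝ,
      (deriv f t * deriv G t - deriv (deriv f) t * G t) /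
          ((deriv f t) ^ 2 + (G t) ^ 2) ^ ((3 : ℝ) / 2) +
        G t / (f t * Real.sqrt ((deriv f t) ^ 2 + (G t) ^ 2)) = -1 / a := by
  have hc2 : c ^ 2 = a ^ 2 + b ^ 2 := by rw [hc, Real.sq_sqrt (by positivity)]
  have hc0 : 0 ≤ c := hc ▸ Real.sqrt_nonneg _
  have hac : a < c := by nlinarith [pow_pos hb 2]
  have hu (t : ℝ) : a < c * Real.cosh t := by nlinarith [Real.one_le_cosh t]
  have hW2 (t : ℝ) : 0 < c ^ 2 * Real.cosh t ^ 2 - a ^ 2 := by nlinarith [hu t]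
  have hW (t : ℝ) : 0 < Real.sqrt (c ^ 2 * Real.cosh t ^ 2 - a ^ 2) := Real.sqrt_pos.2 (hW2 t)
  have hWsq (t : ℝ) := Real.sq_sqrt (hW2 t).le
  have hWd (t : ℝ) : HasDerivAt (fun t => Real.sqrt (c ^ 2 * Real.cosh t ^ 2 - a ^ 2))
      (c ^ 2 * Real.cosh t * Real.sinh t / Real.sqrt (c ^ 2 * Real.cosh t ^ 2 - a ^ 2)) t := by
    convert ((((Real.hasDerivAt_cosh t).pow 2).const_mul (c ^ 2)).sub_const (a ^ 2)).sqrt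
      (hW2 t).ne' using 1
    have := hW t
    simp only [Pi.pow_apply]
    field_simp
    norm_num
    ring
  have hfd (t : ℝ) : HasDerivAt f (G t * (c * Real.sinh t / b)) t := by
    rw [hf, hG]
    refine (((((Real.hasDerivAt_cosh t).const_mul c).sub_const a).const_mul b).fun_div (hWd t)
      (hW t).ne').congr_deriv ?_
    dsimp only
    have h1 := hW t
    have h2 := hWsq t
    have h3 : 0 < c * Real.cosh t + a := by linarith [hu t]
    generalize Real.sqrt (c ^ 2 * Real.cosh t ^ 2 - a ^ 2) = W at *
    field_simp
    rw [h2]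
    ring
  have hGd : Differentiable ℝ G := by
    intro t
    have h3 : 0 < c * Real.cosh t + a := by linarith [hu t]
    rw [hG]
    exact (differentiableAt_const _).div
      ((((Real.hasDerivAt_cosh t).const_mul c).add_const a).differentiableAt.mul
        (hWd t).differentiableAt) (mul_pos h3 (hW t)).ne'
  have hf' : deriv f = fun t => G t * (c * Real.sinh t / b) := funext fun t => (hfd t).deriv
  intro t
  have hf'' : deriv (deriv f) t =
      deriv G t * (c * Real.sinh t / b) + G t * (c * Real.cosh t / b) := by
    rw [hf']
    exact ((hGd t).hasDerivAt.mul
      (((Real.hasDerivAt_sinh t).const_mul c).div_const b)).deriv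
  have h1 := hW t
  have h2 := hWsq t
  have h3 : 0 < c * Real.cosh t + a := by linarith [hu t]
  have h4 : 0 < c * Real.cosh t - a := by linarith [hu t]
  have hs : 0 < a * b / (c * Real.cosh t + a) := by positivity
  have hspeed : deriv f t ^ 2 + G t ^ 2 = (a * b / (c * Real.cosh t + a)) ^ 2 := by
    rw [hf', hG]
    dsimp only
    generalize Real.sqrt (c ^ 2 * Real.cosh t ^ 2 - a ^ 2) = W at *
    field_simp
    rw [h2, Real.sinh_sq]
    linear_combination -hc2
  have hpow : ((a * b / (c * Real.cosh t + a)) ^ 2) ^ ((3 : ℝ) / 2) =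
      (a * b / (c * Real.cosh t + a)) ^ 3 := by
    rw [← Real.rpow_natCast_mul hs.le, ← Real.rpow_natCast]
    norm_num
  have hnum : deriv f t * deriv G t - deriv (deriv f) t * G t =
      -(G t ^ 2 * (c * Real.cosh t / b)) := by
    rw [hf'', hf']
    ring
  rw [hnum, hspeed, hpow, Real.sqrt_sq hs.le, hf, hG]
  dsimp only
  have h5 : c ^ 2 * Real.cosh t ^ 2 - a ^ 2 =
      (c * Real.cosh t + a) * (c * Real.cosh t - a) := by ring
  rw [h5] at h1 h2 ⊢
  generalize Real.sqrt ((c * Real.cosh t + a) * (c * Real.cosh t - a)) = W at *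
  field_simp
  rw [h2]
  ring
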